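/- Let M be a symmetric positive definite real m×m matrix and K a nonsingular real m×m matrix, β > 0. If λ ≠ 1 is an eigenvalue of P^{-1}A (with A, P as defined), then λ = 2β + (z* M z)/(z* K M^{-1} K^T z) for some nonzero z ∈ ℂ^m; in particular every non-unit eigenvalue λ is real and satisfies λ > 2β. -/

import Mathlib

open Matrix

/-- A 3×3 block matrix with square m×m blocks. -/
def blk3 {R : Type*} (m : ℕ)
    (A B C D E F G H I : Matrix (Fin m) (Fin m) R) :
    Matrix (Fin m ⊕ (Fin m ⊕ Fin m)) (Fin m ⊕ (Fin m ⊕ Fin m)) R :=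
  Matrix.of <|
    Sum.elim (fun i => Sum.elim (A i) (Sum.elim (B i) (C i)))
      (Sum.elim (fun i => Sum.elim (D i) (Sum.elim (E i) (F i)))
        (fun i => Sum.elim (G i) (Sum.elim (H i) (I i))))

/-- A block vector with three m-blocks. -/
def vec3 {R : Type*} {m : ℕ} (x y z : Fin m → R) : Fin m ⊕ (Fin m ⊕ Fin m) → R :=
  Sum.elim x (Sum.elim y z)

open scoped ComplexOrder

theorem Matrix.PosDef.map_ofReal {n : Type*} [Fintype n] [DecidableEq n] {M : Matrix n n ℝ}
    (hM : M.PosDef) : (M.map Complex.ofReal).PosDef := by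
  open scoped MatrixOrder Matrix.Norms.L2Operator in
  obtain ⟨B, rfl⟩ := CStarAlgebra.nonneg_iff_eq_star_mul_self.mp hM.posSemidef.nonneg
  have hB : IsUnit B := isUnit_of_mul_isUnit_right hM.isUnit
  have hBc : IsUnit (B.map Complex.ofReal) := hB.map Complex.ofRealHom.mapMatrix
  have hstar : (star B * B).map Complex.ofReal =
      (B.map Complex.ofReal)ᴴ * B.map Complex.ofReal := by
    ext i j
    simp [Matrix.mul_apply, Matrix.star_apply]
  rw [hstar]
  exact .conjTranspose_mul_self _ (mulVec_injective_of_isUnit hBc)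

theorem blk3_mulVec_vec3 {R : Type*} [NonUnitalNonAssocSemiring R] {m : ℕ}
    (A B C D E F G H I : Matrix (Fin m) (Fin m) R) (x y z : Fin m → R) :
    blk3 m A B C D E F G H I *ᵥ vec3 x y z =
      vec3 (A *ᵥ x + (B *ᵥ y + C *ᵥ z)) (D *ᵥ x + (E *ᵥ y + F *ᵥ z))
        (G *ᵥ x + (H *ᵥ y + I *ᵥ z)) := by
  ext (i | i | i) <;> simp [blk3, vec3, mulVec, dotProduct]

theorem vec3_inj {R : Type*} {m : ℕ} {x y z x' y' z' : Fin m → R} :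
    vec3 x y z = vec3 x' y' z' ↔ x = x' ∧ y = y' ∧ z = z' := by
  simp [vec3, Sum.elim_eq_iff]

theorem exists_eq_vec3 {R : Type*} {m : ℕ} (w : Fin m ⊕ (Fin m ⊕ Fin m) → R) :
    ∃ x y z, w = vec3 x y z :=
  ⟨w ∘ Sum.inl, w ∘ Sum.inr ∘ Sum.inl, w ∘ Sum.inr ∘ Sum.inr, by
    ext (i | i | i) <;> rfl⟩

theorem vec3_smul {R : Type*} [Mul R] {m : ℕ} (a : R) (x y z : Fin m → R) :
    a • vec3 x y z = vec3 (a • x) (a • y) (a • z) := by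
  ext (i | i | i) <;> rfl

theorem vec3_zero {R : Type*} [Zero R] {m : ℕ} : vec3 (0 : Fin m → R) 0 0 = 0 := by
  ext (i | i | i) <;> rfl

theorem isUnit_blk3_preconditioner {F : Type*} [Field F] {m : ℕ}
    {M K : Matrix (Fin m) (Fin m) F} (hM : IsUnit M) (hK : IsUnit K) :
    IsUnit (blk3 m 0 K 0 0 M Kᵀ (-M) K 0) := by
  rw [← mulVec_injective_iff_isUnit]
  refine (injective_iff_map_eq_zero (mulVecLin _)).mpr fun w hw => ?_
  obtain ⟨x, y, z, rfl⟩ := exists_eq_vec3 w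
  rw [mulVecLin_apply, blk3_mulVec_vec3, ← vec3_zero, vec3_inj] at hw
  simp only [zero_mulVec, zero_add, add_zero, neg_mulVec] at hw
  obtain ⟨h₁, h₂, h₃⟩ := hw
  have hy : y = 0 := mulVec_injective_of_isUnit hK (by simpa using h₁)
  subst hy
  have hx : x = 0 := mulVec_injective_of_isUnit hM (by simpa using h₃)
  have hz : z = 0 := mulVec_injective_of_isUnit ((isUnit_transpose K).mpr hK) (by simpa using h₂)
  rw [hx, hz, vec3_zero]

/-- The first block `x` of a non-unit generalized eigenvector of the pencil `(A, P)` is nonzero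
and satisfies `M x = (μ - b) K M⁻¹ Kᵀ x`. -/
theorem exists_schur_eigenvector {F : Type*} [Field F] {m : ℕ}
    {M K : Matrix (Fin m) (Fin m) F} (hM : IsUnit M) {b μ : F} (hμ : μ ≠ 1)
    {w : Fin m ⊕ (Fin m ⊕ Fin m) → F} (hw : w ≠ 0)
    (h : blk3 m (b • M) 0 (-M) 0 M Kᵀ (-M) K 0 *ᵥ w =
      μ • (blk3 m 0 K 0 0 M Kᵀ (-M) K 0 *ᵥ w)) :
    ∃ x : Fin m → F, x ≠ 0 ∧ M *ᵥ x = (μ - b) • ((K * M⁻¹ * Kᵀ) *ᵥ x) := by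
  obtain ⟨x, y, z, rfl⟩ := exists_eq_vec3 w
  rw [blk3_mulVec_vec3, blk3_mulVec_vec3, vec3_smul, vec3_inj] at h
  simp only [zero_mulVec, zero_add, add_zero, neg_mulVec, smul_mulVec] at h
  obtain ⟨h₁, h₂, h₃⟩ := h
  have eq_zero {v : Fin m → F} (hv : v = μ • v) : v = 0 := by
    have : (1 - μ) • v = 0 := by rw [sub_smul, one_smul, ← hv, sub_self]
    exact (smul_eq_zero.mp this).resolve_left (sub_ne_zero.mpr hμ.symm)
  have hKy : K *ᵥ y = M *ᵥ x := (neg_add_eq_zero.mp (eq_zero h₃)).symm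
  have hinv : M⁻¹ * M = 1 := nonsing_inv_mul M ((isUnit_iff_isUnit_det M).mp hM)
  have hy : y = -(M⁻¹ *ᵥ (Kᵀ *ᵥ z)) := by
    have := congrArg (M⁻¹ *ᵥ ·) (eq_neg_of_add_eq_zero_left (eq_zero h₂))
    simpa only [mulVec_mulVec, hinv, one_mulVec, mulVec_neg] using this
  have hz : z = (b - μ) • x := by
    apply mulVec_injective_of_isUnit hM
    rw [hKy] at h₁
    rw [mulVec_smul, sub_smul, ← h₁]
    abel
  refine ⟨x, ?_, ?_⟩
  · rintro rfl
    apply hw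
    rw [hy, hz]
    simp [vec3_zero]
  · rw [← hKy, hy, hz]
    simp only [mulVec_smul, mulVec_neg, mulVec_mulVec, Matrix.mul_assoc]
    rw [← neg_smul, neg_sub]

theorem stmt_3 {m : ℕ} (M K : Matrix (Fin m) (Fin m) ℝ)
    (hM : M.PosDef) (hK : IsUnit K) (β : ℝ) (hβ : 0 < β)
    (Mc : Matrix (Fin m) (Fin m) ℂ) (hMc : Mc = M.map Complex.ofReal)
    (Kc : Matrix (Fin m) (Fin m) ℂ) (hKc : Kc = K.map Complex.ofReal)
    (A P : Matrix (Fin m ⊕ (Fin m ⊕ Fin m)) (Fin m ⊕ (Fin m ⊕ Fin m)) ℂ)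
    (hA : A = blk3 m ((2 * (β : ℂ)) • Mc) 0 (-Mc) 0 Mc Kcᵀ (-Mc) Kc 0)
    (hP : P = blk3 m 0 Kc 0 0 Mc Kcᵀ (-Mc) Kc 0)
    (lam : ℂ) (hlam : lam ≠ 1)
    (heig : ∃ w : Fin m ⊕ (Fin m ⊕ Fin m) → ℂ, w ≠ 0 ∧ (P⁻¹ * A) *ᵥ w = lam • w) :
    (∃ z : Fin m → ℂ, z ≠ 0 ∧
        lam = 2 * (β : ℂ) +
          (star z ⬝ᵥ (Mc *ᵥ z)) / (star z ⬝ᵥ ((Kc * Mc⁻¹ * Kcᵀ) *ᵥ z))) ∧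
      lam.im = 0 ∧ 2 * β < lam.re := by
  obtain ⟨w, hw, hwe⟩ := heig
  have hMpos : Mc.PosDef := hMc ▸ hM.map_ofReal
  have hKu : IsUnit Kc := hKc ▸ hK.map Complex.ofRealHom.mapMatrix
  have hPu : IsUnit P := hP ▸ isUnit_blk3_preconditioner hMpos.isUnit hKu
  have hpencil : A *ᵥ w = lam • (P *ᵥ w) := by
    rw [← mulVec_smul, ← hwe, mulVec_mulVec, ← Matrix.mul_assoc,
      mul_nonsing_inv P ((isUnit_iff_isUnit_det P).mp hPu), Matrix.one_mul]
  rw [hA, hP] at hpencil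
  obtain ⟨x, hx, hxe⟩ := exists_schur_eigenvector hMpos.isUnit hlam hw hpencil
  have hKT : Kcᵀ = Kcᴴ := by
    ext i j
    simp [hKc]
  have hSpos : (Kc * Mc⁻¹ * Kcᵀ).PosDef :=
    hKT ▸ hMpos.inv.mul_mul_conjTranspose_same (vecMul_injective_of_isUnit hKu)
  have hp := hMpos.dotProduct_mulVec_pos hx
  have hq := hSpos.dotProduct_mulVec_pos hx
  have hquot : lam - 2 * (β : ℂ) =
      (star x ⬝ᵥ (Mc *ᵥ x)) / (star x ⬝ᵥ ((Kc * Mc⁻¹ * Kcᵀ) *ᵥ x)) := by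
    rw [eq_div_iff hq.ne', hxe, dotProduct_smul, smul_eq_mul]
  have hpos : 0 < lam - 2 * (β : ℂ) := hquot ▸ div_pos hp hq
  refine ⟨⟨x, hx, by rw [← hquot]; ring⟩, ?_⟩
  obtain ⟨hre, him⟩ := Complex.pos_iff.mp hpos
  simp at hre him
  exact ⟨him.symm, hre⟩
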